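/- Suppose there exist δ > 0 and a compact set K ⊂ ℝ with the following properties: (a) the Lebesgue measure of K equals 1; (b) for every ξ ∈ [−1/2, 1/2] there is k ∈ ℤ with ξ + k ∈ K (so K is congruent to [−1/2,1/2] modulo ℤ); (c) for every integer N ≥ 1 and every ξ ∈ K, ∏_{j=1}^{N} M(ξ/2^j) ≥ δ. Then ∑_{k∈ℤ} P_ξ(k) = 1 for almost every ξ ∈ [0,1). -/

import Mathlib

open MeasureTheory Filter Topology Finset

/-- The partial product `∏_{j=1}^N M(x/2^j)`. -/
noncomputable def dyadicProd (M : ℝ → ℝ) (N : ℕ) (x : ℝ) : ℝ :=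
  ∏ j ∈ Finset.range N, M (x / 2 ^ (j + 1))

section DyadicProd

variable {M : ℝ → ℝ}

lemma dyadicProd_nonneg (hM : ∀ x, 0 ≤ M x) (N : ℕ) (x : ℝ) : 0 ≤ dyadicProd M N x :=
  Finset.prod_nonneg fun _ _ => hM _

lemma dyadicProd_succ (N : ℕ) (x : ℝ) :
    dyadicProd M (N + 1) x = dyadicProd M N x * M (x / 2 ^ (N + 1)) :=
  Finset.prod_range_succ _ _

lemma dyadicProd_add (N L : ℕ) (x : ℝ) :
    dyadicProd M (N + L) x = dyadicProd M N x * dyadicProd M L (x / 2 ^ N) := by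
  unfold dyadicProd
  rw [Finset.prod_range_add]
  congr 1
  refine Finset.prod_congr rfl fun j _ => ?_
  rw [div_div, ← pow_add, add_assoc]

lemma dyadicProd_add_two_pow_mul (hM : Function.Periodic M 1) (N : ℕ) (x : ℝ) (m : ℤ) :
    dyadicProd M N (x + 2 ^ N * m) = dyadicProd M N x := by
  refine Finset.prod_congr rfl fun j hj => ?_
  obtain ⟨d, rfl⟩ := Nat.exists_eq_add_of_lt (Finset.mem_range.mp hj)
  have h : (x + 2 ^ (j + d + 1) * (m : ℝ)) / 2 ^ (j + 1)
      = x / 2 ^ (j + 1) + ((2 ^ d * m : ℤ) : ℝ) * 1 := by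
    push_cast
    field_simp
    ring
  rw [h, hM.int_mul]

lemma sum_dyadicProd_eq_one (hM : Function.Periodic M 1) (hsum : ∀ x, M x + M (x + 1 / 2) = 1)
    (N : ℕ) (x : ℝ) : ∑ r ∈ Finset.range (2 ^ N), dyadicProd M N (x + r) = 1 := by
  induction N with
  | zero => simp [dyadicProd]
  | succ N ih =>
    rw [pow_succ, mul_two, Finset.sum_range_add, ← Finset.sum_add_distrib, ← ih]
    refine Finset.sum_congr rfl fun r _ => ?_
    have h₁ : x + ((2 ^ N + r : ℕ) : ℝ) = x + r + 2 ^ N * ((1 : ℤ) : ℝ) := by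
      push_cast
      ring
    have h₂ : (x + r + 2 ^ N * ((1 : ℤ) : ℝ)) / 2 ^ (N + 1)
        = (x + r) / 2 ^ (N + 1) + 1 / 2 := by
      push_cast
      field_simp
      ring
    rw [h₁, dyadicProd_succ, dyadicProd_succ, dyadicProd_add_two_pow_mul hM, h₂, ← mul_add,
      hsum, mul_one]

lemma sum_dyadicProd_le_one (hM : Function.Periodic M 1) (hM0 : ∀ x, 0 ≤ M x)
    (hsum : ∀ x, M x + M (x + 1 / 2) = 1) (N : ℕ) (x : ℝ) (s : Finset ℤ)
    (hs : Set.InjOn (fun k : ℤ => k % 2 ^ N) s) :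
    ∑ k ∈ s, dyadicProd M N (x + k) ≤ 1 := by
  have hpos : (0 : ℤ) < 2 ^ N := by positivity
  have hmod (k : ℤ) : (((k % 2 ^ N).toNat : ℕ) : ℤ) = k % 2 ^ N :=
    Int.toNat_of_nonneg (Int.emod_nonneg k hpos.ne')
  have hinj : Set.InjOn (fun k : ℤ => (k % 2 ^ N).toNat) s := fun a ha b hb hab =>
    hs ha hb (by
      have := congrArg (Nat.cast (R := ℤ)) hab
      simpa only [hmod] using this)
  have hterm (k : ℤ) :
      dyadicProd M N (x + k) = dyadicProd M N (x + ((k % 2 ^ N).toNat : ℕ)) := by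
    have h : (k : ℝ) = (((k % 2 ^ N).toNat : ℕ) : ℝ) + 2 ^ N * ((k / 2 ^ N : ℤ) : ℝ) := by
      have := Int.emod_add_mul_ediv k (2 ^ N)
      rw [← hmod k] at this
      exact_mod_cast this.symm
    conv_lhs => rw [h, ← add_assoc, dyadicProd_add_two_pow_mul hM]
  rw [← sum_dyadicProd_eq_one hM hsum N x, Finset.sum_congr rfl fun k _ => hterm k,
    ← Finset.sum_image (f := fun r : ℕ => dyadicProd M N (x + r)) hinj]
  refine Finset.sum_le_sum_of_subset_of_nonneg ?_ fun _ _ _ => dyadicProd_nonneg hM0 _ _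
  intro r hr
  obtain ⟨k, -, rfl⟩ := Finset.mem_image.mp hr
  have h₁ := Int.emod_lt_of_pos k hpos
  rw [← hmod k] at h₁
  exact Finset.mem_range.mpr (by exact_mod_cast h₁)

lemma eventually_injOn_emod_two_pow (s : Finset ℤ) :
    ∀ᶠ N : ℕ in atTop, Set.InjOn (fun k : ℤ => k % 2 ^ N) s := by
  obtain ⟨B, hB⟩ : ∃ B : ℕ, ∀ k ∈ s, k.natAbs ≤ B :=
    ⟨s.sup Int.natAbs, fun k hk => Finset.le_sup (f := Int.natAbs) hk⟩
  filter_upwards [eventually_ge_atTop (2 * B)] with N hN a ha b hb hab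
  have hlt : ((N : ℕ) : ℤ) < 2 ^ N := by exact_mod_cast Nat.lt_two_pow_self
  have hdvd : (2 ^ N : ℤ) ∣ a - b := Int.ModEq.dvd hab.symm
  have ha' := hB a ha
  have hb' := hB b hb
  have := Int.eq_zero_of_abs_lt_dvd hdvd (by rw [abs_lt]; constructor <;> omega)
  omega

lemma exists_translates_mem {K : Set ℝ}
    (hK : ∀ ξ ∈ Set.Icc (-(1 / 2) : ℝ) (1 / 2), ∃ k : ℤ, ξ + (k : ℝ) ∈ K) (N : ℕ) (x : ℝ) :
    ∃ m : ℕ → ℤ, ∀ r : ℕ, (x + r + 2 ^ N * (m r : ℝ)) / 2 ^ N ∈ K := by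
  have key (y : ℝ) : ∃ k : ℤ, y + (k : ℝ) ∈ K := by
    obtain ⟨k, hk⟩ := hK (y - round y) (abs_le.mp (abs_sub_round y))
    refine ⟨k - round y, ?_⟩
    convert hk using 1
    push_cast
    ring
  choose m hm using fun r : ℕ => key ((x + r) / 2 ^ N)
  refine ⟨m, fun r => ?_⟩
  convert hm r using 1
  field_simp

end DyadicProd

/-- Cohen's condition, period normalized to 1: if there are
`δ > 0` and a compact `K ⊆ ℝ` of Lebesgue measure `1`, congruent to
`[−1/2,1/2]` modulo `ℤ`, on which all partial products
`∏_{j=1}^N M(ξ/2^j)` are `≥ δ`, then `∑_{k∈ℤ} P_ξ(k) = 1` for a.e.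
`ξ ∈ [0,1)`. -/
theorem statement14 (M : ℝ → ℝ)
    (hM01 : ∀ ξ : ℝ, M ξ ∈ Set.Icc (0 : ℝ) 1)
    (hMmeas : Measurable M)
    (hMper : ∀ ξ : ℝ, M (ξ + 1) = M ξ)
    (hMsum : ∀ ξ : ℝ, M ξ + M (ξ + 1 / 2) = 1)
    (hM0 : M 0 = 1)
    (P : ℝ → ℤ → ℝ)
    (hP : ∀ (ξ : ℝ) (k : ℤ),
      Filter.Tendsto (fun N : ℕ => ∏ j ∈ Finset.range (N + 1), M ((ξ + (k : ℝ)) / 2 ^ (j + 1)))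
        atTop (𝓝 (P ξ k)))
    (δ : ℝ) (hδ : 0 < δ)
    (K : Set ℝ) (hKcompact : IsCompact K)
    (hKvol : volume K = 1)
    (hKcong : ∀ ξ ∈ Set.Icc (-(1 / 2) : ℝ) (1 / 2), ∃ k : ℤ, ξ + (k : ℝ) ∈ K)
    (hKlower : ∀ N : ℕ, 1 ≤ N → ∀ ξ ∈ K,
      δ ≤ ∏ j ∈ Finset.range N, M (ξ / 2 ^ (j + 1))) :
    ∀ᵐ ξ ∂(volume.restrict (Set.Ico (0 : ℝ) 1)), ∑' k : ℤ, P ξ k = 1 := by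
  refine Eventually.of_forall fun ξ => ?_
  have hper : Function.Periodic M 1 := hMper
  have hM_nonneg : ∀ x, 0 ≤ M x := fun x => (hM01 x).1
  have hlim (k : ℤ) : Tendsto (fun N => dyadicProd M N (ξ + k)) atTop (𝓝 (P ξ k)) :=
    (tendsto_add_atTop_iff_nat 1).mp (hP ξ k)
  have hP_nonneg (k : ℤ) : 0 ≤ P ξ k :=
    ge_of_tendsto' (hlim k) fun N => dyadicProd_nonneg hM_nonneg N _
  have hP_sum (s : Finset ℤ) : ∑ k ∈ s, P ξ k ≤ 1 :=
    le_of_tendsto (tendsto_finsetSum s fun k _ => hlim k)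
      ((eventually_injOn_emod_two_pow s).mono fun N hN =>
        sum_dyadicProd_le_one hper hM_nonneg hMsum N ξ s hN)
  have hP_summable : Summable (P ξ) := summable_of_sum_le hP_nonneg hP_sum
  refine le_antisymm (hP_summable.tsum_le_of_sum_le hP_sum) ?_
  have hbound (N : ℕ) (k : ℤ) (hk : (ξ + k) / 2 ^ N ∈ K) :
      dyadicProd M N (ξ + k) ≤ P ξ k / δ := by
    rw [le_div_iff₀ hδ]
    refine ge_of_tendsto ((hlim k).comp (tendsto_add_atTop_nat N)) ?_
    filter_upwards [eventually_ge_atTop 1] with L hL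
    rw [Function.comp_apply, add_comm L N, dyadicProd_add]
    exact mul_le_mul_of_nonneg_left (hKlower L hL _ hk) (dyadicProd_nonneg hM_nonneg N _)
  have hf_nonneg (N : ℕ) (k : ℤ) : 0 ≤ min (dyadicProd M N (ξ + k)) (P ξ k / δ) :=
    le_min (dyadicProd_nonneg hM_nonneg N _) (div_nonneg (hP_nonneg k) hδ.le)
  have hf_summable (N : ℕ) : Summable fun k : ℤ => min (dyadicProd M N (ξ + k)) (P ξ k / δ) :=
    (hP_summable.div_const δ).of_nonneg_of_le (hf_nonneg N) fun k => min_le_right _ _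
  have hf_ge (N : ℕ) : 1 ≤ ∑' k : ℤ, min (dyadicProd M N (ξ + k)) (P ξ k / δ) := by
    obtain ⟨m, hm⟩ := exists_translates_mem hKcong N ξ
    set κ : ℕ → ℤ := fun r => r + 2 ^ N * m r with hκ
    have hcast (r : ℕ) : ξ + (κ r : ℝ) = ξ + r + 2 ^ N * (m r : ℝ) := by
      simp only [hκ]
      push_cast
      ring
    have hinj : Set.InjOn κ (Finset.range (2 ^ N)) := by
      intro a ha b hb hab
      have hmod := congrArg (· % (2 ^ N : ℤ)) hab
      simp only [hκ, Int.add_mul_emod_self_left] at hmod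
      have ha' : (a : ℤ) < 2 ^ N := by exact_mod_cast Finset.mem_range.mp ha
      have hb' : (b : ℤ) < 2 ^ N := by exact_mod_cast Finset.mem_range.mp hb
      rw [Int.emod_eq_of_lt (by positivity) ha', Int.emod_eq_of_lt (by positivity) hb'] at hmod
      exact_mod_cast hmod
    calc (1 : ℝ) = ∑ r ∈ Finset.range (2 ^ N), dyadicProd M N (ξ + r) :=
          (sum_dyadicProd_eq_one hper hMsum N ξ).symm
      _ = ∑ r ∈ Finset.range (2 ^ N),
            min (dyadicProd M N (ξ + κ r)) (P ξ (κ r) / δ) := by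
          refine Finset.sum_congr rfl fun r _ => ?_
          rw [min_eq_left (hbound N (κ r) (by rw [hcast]; exact hm r)), hcast,
            dyadicProd_add_two_pow_mul hper]
      _ = ∑ k ∈ (Finset.range (2 ^ N)).image κ,
            min (dyadicProd M N (ξ + k)) (P ξ k / δ) :=
          (Finset.sum_image (f := fun k : ℤ => min (dyadicProd M N (ξ + k)) (P ξ k / δ)) hinj).symm
      _ ≤ _ := (hf_summable N).sum_le_tsum _ fun k _ => hf_nonneg N k
  have hconv : Tendsto (fun N => ∑' k : ℤ, min (dyadicProd M N (ξ + k)) (P ξ k / δ)) atTop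
      (𝓝 (∑' k : ℤ, min (P ξ k) (P ξ k / δ))) := by
    refine tendsto_tsum_of_dominated_convergence (hP_summable.div_const δ)
      (fun k => (hlim k).min tendsto_const_nhds) (Eventually.of_forall fun N k => ?_)
    rw [Real.norm_of_nonneg (hf_nonneg N k)]
    exact min_le_right _ _
  have hmin_summable : Summable fun k => min (P ξ k) (P ξ k / δ) :=
    hP_summable.of_nonneg_of_le
      (fun k => le_min (hP_nonneg k) (div_nonneg (hP_nonneg k) hδ.le)) fun k => min_le_left _ _
  exact (ge_of_tendsto' hconv hf_ge).trans
    (hmin_summable.tsum_le_tsum (fun k => min_le_left _ _) hP_summable)
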